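/- arXiv:0811.3615 — 2 statements merged into one kernel-verified Lean document; each statement's English description precedes it below -/
import Mathlib

section
/- Let V be a real vector space with two linear complex structures J₊ and J₋ (J₊ ∘ J₊ = −id = J₋ ∘ J₋), and let F⁺, F⁻ be alternating bilinear forms on V such that F⁺ tames J₊, i.e. F⁺(v, J₊ v) > 0 for all v ≠ 0, and such that the bilinear form D(v,w) = F⁺(v, J₊ w) − F⁻(J₋ v, w) is alternating, i.e. D(v,w) = −D(w,v) for all v,w. Then g(v,w) = F⁺(v, J₊ w) + F⁺(w, J₊ v) is a symmetric positive-definite bilinear form that is invariant under both complex structures: g(J₊ v, J₊ w) = g(v, w) and g(J₋ v, J₋ w) = g(v, w) for all v, w. -/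
/-- Two taming symplectic forms for two complex structures, whose difference
`F⁺(·, J₊ ·) − F⁻(J₋ ·, ·)` is alternating, determine a single bihermitian
positive definite metric. -/
theorem bisymplectic_gives_bihermitian_metric
    {V : Type*} [AddCommGroup V] [Module ℝ V]
    (Jp Jm : V →ₗ[ℝ] V) (hJp : ∀ v, Jp (Jp v) = -v) (hJm : ∀ v, Jm (Jm v) = -v)
    (Fp Fm : V →ₗ[ℝ] V →ₗ[ℝ] ℝ)
    (hAltp : ∀ v, Fp v v = 0) (hAltm : ∀ v, Fm v v = 0)
    (hTame : ∀ v : V, v ≠ 0 → 0 < Fp v (Jp v))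
    (hD : ∀ v w, Fp v (Jp w) - Fm (Jm v) w = -(Fp w (Jp v) - Fm (Jm w) v)) :
    let g : V → V → ℝ := fun v w => Fp v (Jp w) + Fp w (Jp v)
    (∀ v w, g v w = g w v) ∧
    (∀ v : V, v ≠ 0 → 0 < g v v) ∧
    (∀ v w, g (Jp v) (Jp w) = g v w) ∧
    (∀ v w, g (Jm v) (Jm w) = g v w) := by
  intro g
  have swap_p : ∀ v w, -Fp v w = Fp w v := LinearMap.IsAlt.neg hAltp
  have swap_m : ∀ v w, -Fm v w = Fm w v := LinearMap.IsAlt.neg hAltm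
  have g_eq : ∀ v w, g v w = Fm (Jm v) w + Fm (Jm w) v := fun v w => by
    linarith [hD v w]
  refine ⟨fun v w => add_comm _ _, fun v hv => add_pos (hTame v hv) (hTame v hv),
    fun v w => ?_, fun v w => ?_⟩
  · simp only [g, hJp, map_neg, swap_p]
    exact add_comm _ _
  · simp only [g_eq, hJm, map_neg, LinearMap.neg_apply, swap_m]
    exact add_comm _ _
end

section
/- Let E be a complex normed vector space, A an index set, and {U_α}_{α∈A} a family of open subsets of E. Suppose given real-valued functions K_α : E → ℝ for each α and functions F_{αβ} : E → ℂ for each pair (α,β), such that each F_{αβ} is complex-differentiable on U_α ∩ U_β and K_α(z) − K_β(z) = 2·Re(F_{αβ}(z)) for all z ∈ U_α ∩ U_β. Then for every triple (α,β,γ) such that U_α ∩ U_β ∩ U_γ is preconnected and nonempty, there exists a real number d such that F_{αβ}(z) + F_{βγ}(z) + F_{γα}(z) = i·d for all z ∈ U_α ∩ U_β ∩ U_γ. -/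
/-- The derivative of a holomorphic function vanishes where its real part is locally zero. -/
theorem fderiv_eq_zero_of_re_eventuallyEq_zero
    {E : Type*} [NormedAddCommGroup E] [NormedSpace ℂ E] {f : E → ℂ} {z : E}
    (hf : DifferentiableAt ℂ f z) (hre : ∀ᶠ w in nhds z, (f w).re = 0) :
    fderiv ℂ f z = 0 := by
  let _ : NormedSpace ℝ E := NormedSpace.restrictScalars ℝ ℂ E
  have hR : HasFDerivAt (fun w ↦ (f w).re)
      (Complex.reCLM.comp ((fderiv ℂ f z).restrictScalars ℝ)) z :=
    Complex.reCLM.hasFDerivAt.comp z (hf.hasFDerivAt.restrictScalars ℝ)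
  have h0 : HasFDerivAt (fun w ↦ (f w).re) (0 : E →L[ℝ] ℝ) z :=
    (hasFDerivAt_const (0 : ℝ) z).congr_of_eventuallyEq hre
  have hv (v : E) : (fderiv ℂ f z v).re = 0 := by
    simpa using DFunLike.congr_fun (hR.unique h0) v
  ext v
  apply Complex.ext
  · simpa using hv v
  · simpa using hv (Complex.I • v)

/-- A holomorphic function with vanishing real part on a preconnected open set is constant. -/
theorem IsOpen.exists_const_of_differentiableOn_of_re_eq_zero
    {E : Type*} [NormedAddCommGroup E] [NormedSpace ℂ E] {s : Set E} {f : E → ℂ}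
    (hs : IsOpen s) (hs' : IsPreconnected s) (hf : DifferentiableOn ℂ f s)
    (hre : ∀ z ∈ s, (f z).re = 0) : ∃ c, ∀ z ∈ s, f z = c :=
  hs.exists_is_const_of_fderiv_eq_zero hs' hf fun _ hz ↦
    fderiv_eq_zero_of_re_eventuallyEq_zero (hf.differentiableAt (hs.mem_nhds hz))
      (Filter.eventually_of_mem (hs.mem_nhds hz) hre)

/-- Kähler-type gluing data `K_α − K_β = 2 Re F_{αβ}` with holomorphic
`F_{αβ}` produces purely imaginary constant cocycles on preconnected
nonempty triple overlaps. -/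
theorem kahler_gluing_gives_imaginary_cocycle
    {E : Type*} [NormedAddCommGroup E] [NormedSpace ℂ E] {A : Type*}
    (U : A → Set E) (hUopen : ∀ α, IsOpen (U α))
    (K : A → E → ℝ) (F : A → A → E → ℂ)
    (hF : ∀ α β, DifferentiableOn ℂ (F α β) (U α ∩ U β))
    (hglue : ∀ α β, ∀ z ∈ U α ∩ U β, K α z - K β z = 2 * (F α β z).re) :
    ∀ α β γ, IsPreconnected (U α ∩ U β ∩ U γ) → (U α ∩ U β ∩ U γ).Nonempty →
      ∃ d : ℝ, ∀ z ∈ U α ∩ U β ∩ U γ,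
        F α β z + F β γ z + F γ α z = Complex.I * (d : ℂ) := by
  intro α β γ hconn hne
  have hre : ∀ z ∈ U α ∩ U β ∩ U γ, (F α β z + F β γ z + F γ α z).re = 0 := by
    rintro z ⟨⟨hα, hβ⟩, hγ⟩
    have h₁ := hglue α β z ⟨hα, hβ⟩
    have h₂ := hglue β γ z ⟨hβ, hγ⟩
    have h₃ := hglue γ α z ⟨hγ, hα⟩
    simp only [Complex.add_re]
    linarith
  have hdiff : DifferentiableOn ℂ (fun z ↦ F α β z + F β γ z + F γ α z)
      (U α ∩ U β ∩ U γ) :=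
    (((hF α β).mono fun _ hz ↦ hz.1).add ((hF β γ).mono fun _ hz ↦ ⟨hz.1.2, hz.2⟩)).add
      ((hF γ α).mono fun _ hz ↦ ⟨hz.2, hz.1.1⟩)
  obtain ⟨c, hc⟩ := (((hUopen α).inter (hUopen β)).inter
    (hUopen γ)).exists_const_of_differentiableOn_of_re_eq_zero hconn hdiff hre
  obtain ⟨z₀, hz₀⟩ := hne
  have hc0 : c.re = 0 := hc z₀ hz₀ ▸ hre z₀ hz₀
  refine ⟨c.im, fun z hz ↦ (hc z hz).trans ?_⟩
  apply Complex.ext <;> simp [hc0]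
end
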